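/- Let X be a locally compact zero-dimensional space, let S ⊆ Homeo(X) with 1 ∈ S and S = S⁻¹, let G = ⟨S⟩, and let V₀ be a compact open subset of X. For n ∈ ℕ let V_n = ⋂_{g ∈ Sⁿ} g(V₀), let V_∞ = ⋂_{g ∈ G} g(V₀), and let W_n = V_n \ V_{n+1}. Then for each n ≥ 0, every G-orbit that intersects V_n \ V_∞ also intersects W_m for all 0 ≤ m ≤ n. In particular, if W_n is nonempty, then W_m is nonempty for all 0 ≤ m ≤ n. -/

import Mathlib

open Filter Topology Set Pointwise Uniformity

namespace Reid

/-- The group of self-homeomorphisms of a space, with `(f * g) x = f (g x)`. -/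
instance {X : Type*} [TopologicalSpace X] : Group (X ≃ₜ X) where
  mul f g := g.trans f
  one := Homeomorph.refl X
  inv := Homeomorph.symm
  mul_assoc f g h := Homeomorph.ext fun _ => rfl
  one_mul f := Homeomorph.ext fun _ => rfl
  mul_one f := Homeomorph.ext fun _ => rfl
  inv_mul_cancel f := Homeomorph.ext f.symm_apply_apply

/-- The tautological action of the homeomorphism group on the space. -/
instance {X : Type*} [TopologicalSpace X] : MulAction (X ≃ₜ X) X where
  smul f x := f x
  one_smul _ := rfl
  mul_smul _ _ _ := rfl

/-- A topological space is zero-dimensional if it has a base of clopen sets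
(Hausdorffness is imposed separately as an instance). -/
def ZeroDimensional (X : Type*) [TopologicalSpace X] : Prop :=
  ∃ B : Set (Set X), TopologicalSpace.IsTopologicalBasis B ∧ ∀ U ∈ B, IsClopen U

theorem exists_mem_pow_of_mem_closure {H : Type*} [Group H] {S : Set H} (hS : S⁻¹ = S) {g : H}
    (hg : g ∈ Subgroup.closure S) : ∃ n : ℕ, g ∈ S ^ n := by
  induction hg using Subgroup.closure_induction with
  | mem x hx => exact ⟨1, by simpa using hx⟩
  | one => exact ⟨0, by simp⟩
  | mul x y _ _ hx hy =>
    obtain ⟨a, ha⟩ := hx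
    obtain ⟨b, hb⟩ := hy
    exact ⟨a + b, pow_add S a b ▸ Set.mul_mem_mul ha hb⟩
  | inv x _ hx =>
    obtain ⟨a, ha⟩ := hx
    refine ⟨a, ?_⟩
    rw [← hS, inv_pow]
    exact Set.inv_mem_inv.2 ha

theorem pow_subset_closure {H : Type*} [Group H] (S : Set H) (n : ℕ) :
    S ^ n ⊆ (Subgroup.closure S : Set H) := by
  induction n with
  | zero => simp
  | succ n ih =>
    rw [pow_succ]
    rintro _ ⟨a, ha, b, hb, rfl⟩
    exact mul_mem (ih ha) (Subgroup.subset_closure hb)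

theorem mem_iInter_image_iff {X : Type*} [TopologicalSpace X] {T : Set (X ≃ₜ X)} (hT : T⁻¹ = T)
    (V : Set X) (x : X) : x ∈ ⋂ g ∈ T, (g : X ≃ₜ X) '' V ↔ ∀ g ∈ T, g x ∈ V := by
  simp only [Set.mem_iInter]
  constructor
  · intro h g hg
    obtain ⟨v, hv, hvx⟩ := h g⁻¹ (by rwa [← Set.mem_inv, hT])
    have : g x = v := by
      rw [← hvx]
      exact g.apply_symm_apply v
    rwa [this]
  · intro h g hg
    exact ⟨g⁻¹ x, h _ (by rwa [← Set.mem_inv, hT]), g.apply_symm_apply x⟩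

/-- Lemma 2.6(i): with `1 ∈ S = S⁻¹`, `G = ⟨S⟩`, `V₀` compact open, `V_n = ⋂_{g ∈ Sⁿ} g(V₀)`,
`V_∞ = ⋂_{g ∈ G} g(V₀)` and `W_n = V_n \ V_{n+1}`: every `G`-orbit meeting `V_n \ V_∞` meets
`W_m` for all `m ≤ n`; in particular if `W_n ≠ ∅` then `W_m ≠ ∅` for all `m ≤ n`. -/
theorem orbit_meets_shells {X : Type*} [TopologicalSpace X] [T2Space X] [LocallyCompactSpace X]
    (hzd : ZeroDimensional X)
    (S : Set (X ≃ₜ X)) (hS1 : 1 ∈ S) (hSinv : S⁻¹ = S)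
    (G : Subgroup (X ≃ₜ X)) (hSgen : Subgroup.closure S = G)
    (V0 : Set X) (hV0c : IsCompact V0) (hV0o : IsOpen V0)
    (Vn : ℕ → Set X) (hVn : ∀ n : ℕ, Vn n = ⋂ g ∈ S ^ n, (g : X ≃ₜ X) '' V0)
    (Vinf : Set X) (hVinf : Vinf = ⋂ g ∈ G, (g : X ≃ₜ X) '' V0)
    (Wn : ℕ → Set X) (hWn : ∀ n : ℕ, Wn n = Vn n \ Vn (n + 1)) :
    (∀ n : ℕ, ∀ x : X, (MulAction.orbit G x ∩ (Vn n \ Vinf)).Nonempty →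
      ∀ m ≤ n, (MulAction.orbit G x ∩ Wn m).Nonempty) ∧
    ∀ n : ℕ, (Wn n).Nonempty → ∀ m ≤ n, (Wn m).Nonempty := by
  have memV (n : ℕ) (x : X) : x ∈ Vn n ↔ ∀ g ∈ S ^ n, g x ∈ V0 := by
    rw [hVn]
    exact mem_iInter_image_iff (by rw [← inv_pow, hSinv]) V0 x
  have memInf (x : X) : x ∈ Vinf ↔ ∀ g ∈ G, g x ∈ V0 := by
    rw [hVinf]
    exact mem_iInter_image_iff (T := (G : Set (X ≃ₜ X))) (by simp) V0 x
  have powG (n : ℕ) {g : X ≃ₜ X} (hg : g ∈ S ^ n) : g ∈ G :=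
    hSgen ▸ pow_subset_closure S n hg
  have orbit_meets (n : ℕ) (x : X) (h : (MulAction.orbit G x ∩ (Vn n \ Vinf)).Nonempty) :
      ∀ m ≤ n, (MulAction.orbit G x ∩ Wn m).Nonempty := by
    classical
    intro m hm
    obtain ⟨y, hyx, hyn, hyi⟩ := h
    have hex : ∃ k : ℕ, ∃ g ∈ S ^ k, g y ∉ V0 := by
      rw [memInf] at hyi
      push Not at hyi
      obtain ⟨g, hg, hgy⟩ := hyi
      obtain ⟨k, hk⟩ := exists_mem_pow_of_mem_closure hSinv (hSgen.symm ▸ hg)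
      exact ⟨k, g, hk, hgy⟩
    obtain ⟨g, hg, hgy⟩ := Nat.find_spec hex
    have hmin (j : ℕ) (hj : j < Nat.find hex) (r : X ≃ₜ X) (hr : r ∈ S ^ j) : r y ∈ V0 := by
      by_contra hry
      exact Nat.find_min hex hj ⟨r, hr, hry⟩
    have hnk : n < Nat.find hex := by
      by_contra! hle
      exact hgy ((memV n y).1 hyn g (Set.pow_subset_pow_right hS1 hle hg))
    obtain ⟨d, hd⟩ : ∃ d, Nat.find hex = (m + 1) + d := ⟨Nat.find hex - (m + 1), by omega⟩
    rw [hd, pow_add] at hg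
    obtain ⟨s, hs, t, ht, rfl⟩ := hg
    refine ⟨t y, ?_, ?_⟩
    · exact MulAction.mem_orbit_of_mem_orbit (⟨t, powG d ht⟩ : G) hyx
    · rw [hWn]
      refine ⟨(memV m _).2 fun r hr => ?_, fun hV => hgy ((memV (m + 1) _).1 hV s hs)⟩
      exact hmin (m + d) (by omega) (r * t) (pow_add S m d ▸ Set.mul_mem_mul hr ht)
  refine ⟨orbit_meets, fun n hn m hm => ?_⟩
  obtain ⟨x, hx⟩ := hn
  rw [hWn] at hx
  have hxi : x ∉ Vinf := fun hi =>
    hx.2 ((memV (n + 1) x).2 fun g hg => (memInf x).1 hi g (powG _ hg))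
  exact (orbit_meets n x ⟨x, MulAction.mem_orbit_self x, hx.1, hxi⟩ m hm).mono
    Set.inter_subset_right

end Reid
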